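/- arXiv:2407.07231 — 3 statements merged into one kernel-verified Lean document; each statement's English description precedes it below -/
import Mathlib

section
/- With E, g, K(t,s) = ⟨g(t), g(s)⟩, orthonormal eigenfunctions (φₙ)_{n ∈ ℕ} in L²(T, ℂ) with eigenvalues λₙ > 0 and πₙ := ∫_T φₙ(t) • g(t) dt as above (each t ↦ φₙ(t)•g(t) Bochner integrable), suppose in addition the pointwise trace condition Σ_n λₙ·|φₙ(t)|² = K(t,t) holds at a point t ∈ T. Then g(t) lies in the closed linear span of {πₙ : n ∈ ℕ}; explicitly, g(t) = Σ_n conj(φₙ(t)) • πₙ with the series converging in E. -/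
open MeasureTheory
open scoped ComplexInnerProductSpace

/-- Expansion of a vector along an orthogonal family: if the coefficients exhaust the norm of `x`,
the expansion converges to `x`. -/
theorem hasSum_smul_of_hasSum_norm_sq {ι E : Type*} [NormedAddCommGroup E]
    [InnerProductSpace ℂ E] [DecidableEq ι] {v : ι → E} {x : E} {c : ι → ℂ} {l : ι → ℝ}
    (hv : ∀ i j, ⟪v i, v j⟫ = (l j : ℂ) * if i = j then 1 else 0)
    (hx : ∀ i, ⟪x, v i⟫ = (l i : ℂ) * c i)
    (hsum : HasSum (fun i => ((l i * ‖c i‖ ^ 2 : ℝ) : ℂ)) ⟪x, x⟫) :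
    HasSum (fun i => (starRingEnd ℂ) (c i) • v i) x := by
  have hcc : ∀ i, (starRingEnd ℂ) (c i) * ((l i : ℂ) * c i) = ((l i * ‖c i‖ ^ 2 : ℝ) : ℂ) :=
    fun i => by
      push_cast
      rw [← Complex.conj_mul']
      ring
  have hxs : ∀ s : Finset ι, ⟪x, ∑ i ∈ s, (starRingEnd ℂ) (c i) • v i⟫
      = ∑ i ∈ s, ((l i * ‖c i‖ ^ 2 : ℝ) : ℂ) := fun s => by
    simp only [inner_sum, inner_smul_right, hx, hcc]
  have hsx : ∀ s : Finset ι, ⟪∑ i ∈ s, (starRingEnd ℂ) (c i) • v i, x⟫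
      = ∑ i ∈ s, ((l i * ‖c i‖ ^ 2 : ℝ) : ℂ) := fun s => by
    rw [← inner_conj_symm, hxs, map_sum]
    simp only [Complex.conj_ofReal]
  have hss : ∀ s : Finset ι, ⟪∑ i ∈ s, (starRingEnd ℂ) (c i) • v i,
      ∑ i ∈ s, (starRingEnd ℂ) (c i) • v i⟫ = ∑ i ∈ s, ((l i * ‖c i‖ ^ 2 : ℝ) : ℂ) := fun s => by
    simp only [inner_sum, sum_inner, inner_smul_right, inner_smul_left, hv, Complex.conj_conj]
    refine Finset.sum_congr rfl fun i hi => ?_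
    simp only [mul_ite, mul_one, mul_zero, Finset.sum_ite_eq', hi, if_true]
    rw [← hcc i]
    ring
  have hself : ∀ y : E, ((‖y‖ ^ 2 : ℝ) : ℂ) = ⟪y, y⟫ := fun y => by
    simp [inner_self_eq_norm_sq_to_K]
  have hnorm : ∀ s : Finset ι, ((‖∑ i ∈ s, (starRingEnd ℂ) (c i) • v i - x‖ ^ 2 : ℝ) : ℂ)
      = ⟪x, x⟫ - ∑ i ∈ s, ((l i * ‖c i‖ ^ 2 : ℝ) : ℂ) := fun s => by
    rw [hself, inner_sub_sub_self, hss, hsx, hxs]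
    ring
  have hlim : Filter.Tendsto
      (fun s : Finset ι => ‖∑ i ∈ s, (starRingEnd ℂ) (c i) • v i - x‖ ^ 2)
      Filter.atTop (nhds 0) := by
    rw [← Filter.tendsto_ofReal_iff, Complex.ofReal_zero]
    have h := (tendsto_const_nhds (x := ⟪x, x⟫)).sub hsum
    rw [sub_self] at h
    simpa only [hnorm, SummationFilter.unconditional_filter] using h
  have hlim' := hlim.sqrt
  simp only [Real.sqrt_sq (norm_nonneg _), Real.sqrt_zero] at hlim'
  exact tendsto_iff_norm_sub_tendsto_zero.2 hlim'

/-- Under the pointwise trace condition `Σₙ λₙ |φₙ(t)|² = K(t,t)` at a point `t ∈ T`,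
the feature vector `g(t)` lies in the closed span of the `πₙ`; explicitly
`g(t) = Σₙ conj(φₙ(t)) • πₙ` with the series converging in `E`. -/
theorem stmt6 {E : Type*} [NormedAddCommGroup E] [InnerProductSpace ℂ E] [CompleteSpace E]
    (T : Set ℝ) (hT : MeasurableSet T) (g : ℝ → E) (K : ℝ → ℝ → ℂ)
    (hK : ∀ t s : ℝ, K t s = ⟪g t, g s⟫)
    (φ : ℕ → ℝ → ℂ) (lam : ℕ → ℝ) (hlam : ∀ n, 0 < lam n)
    (horth : ∀ n m : ℕ,
      ∫ t in T, (starRingEnd ℂ) (φ n t) * φ m t = if n = m then 1 else 0)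
    (heig : ∀ n : ℕ, ∀ t ∈ T, ∫ s in T, K t s * φ n s = (lam n : ℂ) * φ n t)
    (hint : ∀ n : ℕ, IntegrableOn (fun t => φ n t • g t) T)
    (π : ℕ → E) (hπ : ∀ n : ℕ, π n = ∫ t in T, φ n t • g t)
    (t : ℝ) (ht : t ∈ T)
    (htrace : HasSum (fun n : ℕ => ((lam n * ‖φ n t‖ ^ 2 : ℝ) : ℂ)) (K t t)) :
    HasSum (fun n : ℕ => (starRingEnd ℂ) (φ n t) • π n) (g t) ∧
    g t ∈ closure (Submodule.span ℂ (Set.range π) : Set E) := by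
  have hgπ : ∀ n, ∀ u ∈ T, ⟪g u, π n⟫ = (lam n : ℂ) * φ n u := fun n u hu => by
    rw [hπ, ← integral_inner (hint n), ← heig n u hu]
    simp only [inner_smul_right, hK, mul_comm]
  have hππ : ∀ n m, ⟪π n, π m⟫ = (lam m : ℂ) * if n = m then 1 else 0 := fun n m => by
    rw [← inner_conj_symm, hπ n, ← integral_inner (hint n), ← integral_conj, ← horth n m,
      ← integral_const_mul]
    refine setIntegral_congr_fun hT fun u hu => ?_
    simp only [inner_smul_right, map_mul, inner_conj_symm, hgπ m u hu]
    ring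
  rw [hK] at htrace
  have hsum := hasSum_smul_of_hasSum_norm_sq hππ (fun n => hgπ n t ht) htrace
  exact ⟨hsum, mem_closure_of_tendsto hsum <| Filter.Eventually.of_forall fun s =>
    Submodule.sum_mem _ fun n _ => Submodule.smul_mem _ _ (Submodule.subset_span ⟨n, rfl⟩)⟩
end

section
/- (Isometry of the complex-trajectory map.) With E, g : T → E, K(t,s) = ⟨g(t), g(s)⟩, orthonormal eigenfunctions (φₙ)_{n ∈ ℕ}, eigenvalues λₙ > 0, and πₙ := ∫_T φₙ(t)•g(t) dt as above, assume the trace condition Σ_n λₙ·|φₙ(t)|² = K(t,t) holds for every t ∈ T. Then for all f₁, f₂ in the closed linear span of {g(t) : t ∈ T}, the series Σ_n (1/λₙ)·⟨f₁, πₙ⟩·⟨πₙ, f₂⟩ converges and equals ⟨f₁, f₂⟩. (This expresses that the map sending f to the complex trajectory ζ_t(f)* = ⟨g(t), f⟩, with RKHS inner product ⟨u,v⟩ = Σ_n (1/λₙ) conj(uₙ) vₙ on Mercer coefficients, is an isometry: ⟨ζ(f₁)*, ζ(f₂)*⟩_H = ⟨f₁, f₂⟩.) -/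
open MeasureTheory
open scoped ComplexInnerProductSpace

/-- An orthonormal family is a Hilbert basis of its closed span. -/
theorem Orthonormal.exists_hilbertBasis_closure_span {𝕜 E ι : Type*} [RCLike 𝕜]
    [NormedAddCommGroup E] [InnerProductSpace 𝕜 E] [CompleteSpace E] {e : ι → E}
    (he : Orthonormal 𝕜 e) :
    ∃ b : HilbertBasis ι 𝕜 (Submodule.span 𝕜 (Set.range e)).topologicalClosure,
      ∀ i, (b i : E) = e i := by
  set U := (Submodule.span 𝕜 (Set.range e)).topologicalClosure
  have hmem (i : ι) : e i ∈ U :=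
    Submodule.le_topologicalClosure _ (Submodule.subset_span ⟨i, rfl⟩)
  let v : ι → U := fun i => ⟨e i, hmem i⟩
  have hv : Orthonormal 𝕜 v := by
    rw [← U.subtypeₗᵢ.orthonormal_comp_iff]
    exact he
  have hsp : (Submodule.span 𝕜 (Set.range v))ᗮ = ⊥ := by
    rw [eq_bot_iff]
    intro x hx
    have hx' : (x : E) ∈ Uᗮ := by
      refine (Submodule.orthogonal_closure (Submodule.span 𝕜 (Set.range e))).ge ?_
      rw [Submodule.mem_orthogonal]
      intro y hy
      induction hy using Submodule.span_induction with
      | mem y hy =>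
        obtain ⟨i, rfl⟩ := hy
        exact (Submodule.mem_orthogonal _ _).1 hx (v i) (Submodule.subset_span ⟨i, rfl⟩)
      | zero => simp
      | add y z _ _ hy hz => rw [inner_add_left, hy, hz, add_zero]
      | smul c y _ hy => rw [inner_smul_left, hy, mul_zero]
    have h0 : inner 𝕜 (x : E) (x : E) = 0 := Submodule.inner_right_of_mem_orthogonal x.2 hx'
    exact (Submodule.mem_bot 𝕜).2 (Subtype.ext (inner_self_eq_zero.1 h0))
  exact ⟨HilbertBasis.mkOfOrthogonalEqBot hv hsp, fun i => by
    rw [HilbertBasis.coe_mkOfOrthogonalEqBot]⟩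

/-- A vector for which equality holds in Bessel's inequality lies in the closed span. -/
theorem Orthonormal.mem_closure_span_of_hasSum {𝕜 E ι : Type*} [RCLike 𝕜]
    [NormedAddCommGroup E] [InnerProductSpace 𝕜 E] [CompleteSpace E] {e : ι → E}
    (he : Orthonormal 𝕜 e) {x : E}
    (hx : HasSum (fun i => inner 𝕜 x (e i) * inner 𝕜 (e i) x) (inner 𝕜 x x)) :
    x ∈ (Submodule.span 𝕜 (Set.range e)).topologicalClosure := by
  obtain ⟨b, hb⟩ := he.exists_hilbertBasis_closure_span
  have h := b.hasSum_inner_mul_inner (Submodule.orthogonalProjectionOnto _ x)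
    (Submodule.orthogonalProjectionOnto _ x)
  simp only [Submodule.inner_orthogonalProjectionOnto_eq_of_mem_left,
    Submodule.inner_orthogonalProjectionOnto_eq_of_mem_right, hb] at h
  have hproj := h.unique hx
  rw [Submodule.mem_iff_norm_starProjection, ← sq_eq_sq₀ (norm_nonneg _) (norm_nonneg _)]
  rw [← Submodule.inner_orthogonalProjectionOnto_eq_of_mem_left, inner_self_eq_norm_sq_to_K,
    inner_self_eq_norm_sq_to_K] at hproj
  exact_mod_cast hproj

/-- Parseval's identity for an orthonormal family on its closed span. -/
theorem Orthonormal.hasSum_inner_mul_inner {𝕜 E ι : Type*} [RCLike 𝕜]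
    [NormedAddCommGroup E] [InnerProductSpace 𝕜 E] [CompleteSpace E] {e : ι → E}
    (he : Orthonormal 𝕜 e) {x y : E}
    (hx : x ∈ (Submodule.span 𝕜 (Set.range e)).topologicalClosure)
    (hy : y ∈ (Submodule.span 𝕜 (Set.range e)).topologicalClosure) :
    HasSum (fun i => inner 𝕜 x (e i) * inner 𝕜 (e i) y) (inner 𝕜 x y) := by
  obtain ⟨b, hb⟩ := he.exists_hilbertBasis_closure_span
  simpa only [Submodule.coe_inner, hb] using b.hasSum_inner_mul_inner ⟨x, hx⟩ ⟨y, hy⟩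

/-- Isometry of the complex-trajectory map: under the trace condition
`Σₙ λₙ|φₙ(t)|² = K(t,t)` for all `t ∈ T`, for any `f₁, f₂` in the closed span of
`{g(t) : t ∈ T}` the RKHS inner product of the Mercer coefficients `⟨πₙ, f⟩` of the
complex trajectories reproduces the feature-space inner product:
`Σₙ (1/λₙ) ⟨f₁, πₙ⟩ ⟨πₙ, f₂⟩ = ⟨f₁, f₂⟩`. -/
theorem stmt7 {E : Type*} [NormedAddCommGroup E] [InnerProductSpace ℂ E] [CompleteSpace E]
    (T : Set ℝ) (hT : MeasurableSet T) (g : ℝ → E) (K : ℝ → ℝ → ℂ)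
    (hK : ∀ t s : ℝ, K t s = ⟪g t, g s⟫)
    (φ : ℕ → ℝ → ℂ) (lam : ℕ → ℝ) (hlam : ∀ n, 0 < lam n)
    (horth : ∀ n m : ℕ,
      ∫ t in T, (starRingEnd ℂ) (φ n t) * φ m t = if n = m then 1 else 0)
    (heig : ∀ n : ℕ, ∀ t ∈ T, ∫ s in T, K t s * φ n s = (lam n : ℂ) * φ n t)
    (hint : ∀ n : ℕ, IntegrableOn (fun t => φ n t • g t) T)
    (π : ℕ → E) (hπ : ∀ n : ℕ, π n = ∫ t in T, φ n t • g t)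
    (htrace : ∀ t ∈ T, HasSum (fun n : ℕ => ((lam n * ‖φ n t‖ ^ 2 : ℝ) : ℂ)) (K t t))
    (f₁ f₂ : E)
    (hf₁ : f₁ ∈ closure (Submodule.span ℂ (g '' T) : Set E))
    (hf₂ : f₂ ∈ closure (Submodule.span ℂ (g '' T) : Set E)) :
    HasSum (fun n : ℕ => (1 / (lam n : ℂ)) * ⟪f₁, π n⟫ * ⟪π n, f₂⟫) ⟪f₁, f₂⟫ := by
  have hgπ (n : ℕ) (t : ℝ) (ht : t ∈ T) : ⟪g t, π n⟫ = (lam n : ℂ) * φ n t := by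
    rw [hπ, ← integral_inner (hint n), ← heig n t ht]
    refine integral_congr_ae (.of_forall fun s => ?_)
    simp only [inner_smul_right, hK, mul_comm]
  have hππ (m n : ℕ) : ⟪π m, π n⟫ = if m = n then (lam m : ℂ) else 0 := by
    have h : ⟪π m, π n⟫ = ∫ t in T, (lam m : ℂ) * ((starRingEnd ℂ) (φ m t) * φ n t) := by
      conv_lhs => rw [hπ n, ← integral_inner (hint n)]
      refine setIntegral_congr_fun hT fun t ht => ?_
      simp only [inner_smul_right]
      rw [← inner_conj_symm, hgπ m t ht, map_mul, Complex.conj_ofReal]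
      ring
    rw [h, integral_const_mul, horth, mul_ite, mul_one, mul_zero]
  have hsq (n : ℕ) : ((√(lam n) : ℝ) : ℂ)⁻¹ * ((√(lam n) : ℝ) : ℂ)⁻¹ = (lam n : ℂ)⁻¹ := by
    rw [← mul_inv, ← Complex.ofReal_mul, Real.mul_self_sqrt (hlam n).le]
  have hne (n : ℕ) : (lam n : ℂ) ≠ 0 := Complex.ofReal_ne_zero.2 (hlam n).ne'
  let e : ℕ → E := fun n => ((√(lam n) : ℝ) : ℂ)⁻¹ • π n
  have he : Orthonormal ℂ e := by
    rw [orthonormal_iff_ite]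
    intro m n
    simp only [e, inner_smul_left, inner_smul_right, hππ, map_inv₀, Complex.conj_ofReal]
    split_ifs with h
    · subst h
      rw [← mul_assoc, hsq, inv_mul_cancel₀ (hne m)]
    · simp
  have hterm (x y : E) (n : ℕ) :
      ⟪x, e n⟫ * ⟪e n, y⟫ = (1 / (lam n : ℂ)) * ⟪x, π n⟫ * ⟪π n, y⟫ := by
    simp only [e, inner_smul_left, inner_smul_right, map_inv₀, Complex.conj_ofReal]
    rw [one_div, ← hsq]
    ring
  have hgmem : g '' T ⊆ (Submodule.span ℂ (Set.range e)).topologicalClosure := by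
    rintro _ ⟨t, ht, rfl⟩
    refine he.mem_closure_span_of_hasSum ?_
    rw [← hK]
    refine (congrArg (HasSum · (K t t)) (funext fun n => ?_)).mpr (htrace t ht)
    rw [hterm, ← inner_conj_symm (π n), hgπ n t ht, map_mul, Complex.conj_ofReal]
    have hnorm := Complex.mul_conj' (φ n t)
    have hn := hne n
    push_cast
    rw [← hnorm]
    field_simp
  have hmem {f : E} (hf : f ∈ closure (Submodule.span ℂ (g '' T) : Set E)) :
      f ∈ (Submodule.span ℂ (Set.range e)).topologicalClosure :=
    closure_minimal (Submodule.span_le.2 hgmem) (Submodule.isClosed_topologicalClosure _) hf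
  simpa only [hterm] using he.hasSum_inner_mul_inner (hmem hf₁) (hmem hf₂)
end

section
/- (Quadrature commutation relations.) Let A be a unital star algebra over ℂ (a StarRing which is a ℂ-algebra with star(c • a) = conj(c) • star(a)), let K : ℝ × ℝ → ℂ, and let Z : ℝ → A satisfy, for all t,s: Z(t)·Z(s) = Z(s)·Z(t) and Z(t)*·Z(s) − Z(s)·Z(t)* = K(t,s) • 1. Define the quadratures X(t) := (Z(t) + Z(t)*)/2 and Y(t) := (Z(t) − Z(t)*)/(2i). Then for all t,s: [X(t), X(s)] = ((i/2)·Im K(t,s)) • 1, [Y(t), Y(s)] = ((i/2)·Im K(t,s)) • 1, and [X(t), Y(s)] = ((1/(2i))·Re K(t,s)) • 1, where [a,b] := a·b − b·a. -/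
/-- Scalars pull out of a commutator. -/
theorem smul_mul_smul_sub_comm {A : Type*} [Ring A] [Algebra ℂ A] (c d : ℂ) (a b : A) :
    (c • a) * (d • b) - (d • b) * (c • a) = (c * d) • (a * b - b * a) := by
  rw [smul_mul_smul_comm, smul_mul_smul_comm, mul_comm d c, smul_sub]

/-- Quadrature commutation relations: if `Z(t)` mutually commute and satisfy
`Z(t)* Z(s) − Z(s) Z(t)* = K(t,s) • 1`, then the quadratures
`X = (Z + Z*)/2`, `Y = (Z − Z*)/(2i)` satisfy
`[X(t),X(s)] = [Y(t),Y(s)] = (i/2) Im K(t,s) • 1` and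
`[X(t),Y(s)] = (1/(2i)) Re K(t,s) • 1`. -/
theorem stmt10 {A : Type*} [Ring A] [Algebra ℂ A] [StarRing A] [StarModule ℂ A]
    (K : ℝ → ℝ → ℂ) (Z : ℝ → A)
    (hcomm : ∀ t s : ℝ, Z t * Z s = Z s * Z t)
    (hccr : ∀ t s : ℝ, star (Z t) * Z s - Z s * star (Z t) = (K t s) • (1 : A))
    (X Y : ℝ → A)
    (hX : ∀ t : ℝ, X t = ((1 : ℂ) / 2) • (Z t + star (Z t)))
    (hY : ∀ t : ℝ, Y t = ((1 : ℂ) / (2 * Complex.I)) • (Z t - star (Z t))) :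
    ∀ t s : ℝ,
      X t * X s - X s * X t = ((Complex.I / 2) * ((K t s).im : ℂ)) • (1 : A) ∧
      Y t * Y s - Y s * Y t = ((Complex.I / 2) * ((K t s).im : ℂ)) • (1 : A) ∧
      X t * Y s - Y s * X t = (((1 : ℂ) / (2 * Complex.I)) * ((K t s).re : ℂ)) • (1 : A) := by
  intro t s
  have hstar : ∀ t s : ℝ, star (Z t) * star (Z s) - star (Z s) * star (Z t) = 0 := fun t s => by
    rw [← star_mul, ← star_mul, hcomm, sub_self]
  have hconj : Z t * star (Z s) - star (Z s) * Z t = (-(starRingEnd ℂ (K t s))) • (1 : A) := by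
    have h := congrArg star (hccr t s)
    simp only [star_sub, star_mul, star_star, star_smul, star_one] at h
    rw [neg_smul, starRingEnd_apply, ← h, neg_sub]
  have hzero : Z t * Z s - Z s * Z t = 0 := sub_eq_zero.mpr (hcomm t s)
  have hXX : (Z t + star (Z t)) * (Z s + star (Z s)) - (Z s + star (Z s)) * (Z t + star (Z t))
      = (K t s - starRingEnd ℂ (K t s)) • (1 : A) := by
    rw [sub_eq_add_neg (K t s), add_smul, ← hccr, ← hconj]
    linear_combination (norm := noncomm_ring) hzero + hstar t s
  have hYY : (Z t - star (Z t)) * (Z s - star (Z s)) - (Z s - star (Z s)) * (Z t - star (Z t))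
      = (-(K t s - starRingEnd ℂ (K t s))) • (1 : A) := by
    rw [neg_smul, sub_eq_add_neg (K t s), add_smul, ← hccr, ← hconj]
    linear_combination (norm := noncomm_ring) hzero + hstar t s
  have hXY : (Z t + star (Z t)) * (Z s - star (Z s)) - (Z s - star (Z s)) * (Z t + star (Z t))
      = (K t s + starRingEnd ℂ (K t s)) • (1 : A) := by
    rw [← sub_neg_eq_add (K t s), sub_smul, ← hccr, ← hconj]
    linear_combination (norm := noncomm_ring) hzero - hstar t s
  simp only [hX, hY, smul_mul_smul_sub_comm, hXX, hYY, hXY, smul_smul, Complex.sub_conj,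
    Complex.add_conj]
  have hI : Complex.I ≠ 0 := Complex.I_ne_zero
  refine ⟨?_, ?_, ?_⟩ <;> congr 1 <;> push_cast
  · ring
  · field_simp
    linear_combination (-(K t s).im : ℂ) * Complex.I_sq
  · ring
end
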